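/- arXiv:2301.08324 — 3 statements merged into one kernel-verified Lean document; each statement's English description precedes it below -/
import Mathlib

section
/- Let σ > 0, let μ be the Gaussian measure on ℝ with mean 0 and variance σ², and let k ≥ 1 be an integer. Then there exists a constant C > 0 (depending only on σ and k) such that for all a ≥ σ, the conditional even moment satisfies | (∫_{[-a,a]} x^{2k} dμ(x)) / μ([-a,a]) − σ^{2k} (2k−1)!! | ≤ C · a^{2k−1} · exp(−a²/(2σ²)). -/
open MeasureTheory ProbabilityTheory Real Set Finset

lemma aux_rec (σ : ℝ) (hσ : 0 < σ) (a : ℝ) (k : ℕ) :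
    ∫ x in (-a)..a, x ^ (2 * (k + 1)) * Real.exp (-x ^ 2 / (2 * σ ^ 2)) =
      σ ^ 2 * (2 * (k : ℝ) + 1) * (∫ x in (-a)..a, x ^ (2 * k) * Real.exp (-x ^ 2 / (2 * σ ^ 2)))
        - 2 * σ ^ 2 * a ^ (2 * k + 1) * Real.exp (-a ^ 2 / (2 * σ ^ 2)) := by
  have hd : ∀ x : ℝ, HasDerivAt
      (fun x : ℝ => -σ ^ 2 * (x ^ (2 * k + 1) * Real.exp (-x ^ 2 / (2 * σ ^ 2))))
      (x ^ (2 * (k + 1)) * Real.exp (-x ^ 2 / (2 * σ ^ 2)) -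
        σ ^ 2 * (2 * (k : ℝ) + 1) * (x ^ (2 * k) * Real.exp (-x ^ 2 / (2 * σ ^ 2)))) x := by
    intro x
    have h1 : HasDerivAt (fun x : ℝ => -x ^ 2 / (2 * σ ^ 2)) (-(2 * x) / (2 * σ ^ 2)) x := by
      simpa using ((hasDerivAt_pow 2 x).neg).div_const (2 * σ ^ 2)
    have h2 := ((hasDerivAt_pow (2 * k + 1) x).mul h1.exp).const_mul (-σ ^ 2)
    refine HasDerivAt.congr_deriv (f := fun x : ℝ => -σ ^ 2 * (x ^ (2 * k + 1) * Real.exp (-x ^ 2 / (2 * σ ^ 2)))) h2 ?_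
    have : 2 * k + 1 - 1 = 2 * k := by omega
    rw [this]
    push_cast
    field_simp
    ring
  have hi : ∀ n : ℕ, IntervalIntegrable
      (fun x : ℝ => x ^ n * Real.exp (-x ^ 2 / (2 * σ ^ 2))) volume (-a) a := by
    intro n
    apply Continuous.intervalIntegrable
    fun_prop
  have h := intervalIntegral.integral_eq_sub_of_hasDerivAt (a := -a) (b := a)
    (fun x _ => hd x) ((hi _).sub ((hi _).const_mul _))
  rw [intervalIntegral.integral_sub (hi _) ((hi _).const_mul _),
    intervalIntegral.integral_const_mul] at h
  have e : (-a) ^ (2 * k + 1) = - a ^ (2 * k + 1) := Odd.neg_pow ⟨k, rfl⟩ a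
  rw [e, neg_sq] at h
  linarith

lemma aux_ratio (σ : ℝ) (hσ : 0 < σ) (k : ℕ) :
    ∃ C : ℝ, 0 < C ∧ ∀ a : ℝ, σ ≤ a →
      |(∫ x in (-a)..a, x ^ (2 * k) * Real.exp (-x ^ 2 / (2 * σ ^ 2))) /
            (∫ x in (-a)..a, Real.exp (-x ^ 2 / (2 * σ ^ 2))) -
          σ ^ (2 * k) * ∏ i ∈ Finset.range k, (2 * (i : ℝ) + 1)| * a ≤
        C * a ^ (2 * k) * Real.exp (-a ^ 2 / (2 * σ ^ 2)) := by
  have hi : ∀ a b : ℝ, IntervalIntegrable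
      (fun x : ℝ => Real.exp (-x ^ 2 / (2 * σ ^ 2))) volume a b := by
    intro a b
    apply Continuous.intervalIntegrable
    fun_prop
  obtain ⟨m, hm⟩ : ∃ m, m = ∫ x in (-σ)..σ, Real.exp (-x ^ 2 / (2 * σ ^ 2)) := ⟨_, rfl⟩
  have hm0 : 0 < m := by
    rw [hm]
    exact intervalIntegral.intervalIntegral_pos_of_pos (hi _ _) (fun x => Real.exp_pos _)
      (by linarith)
  have hJ : ∀ a, σ ≤ a → m ≤ ∫ x in (-a)..a, Real.exp (-x ^ 2 / (2 * σ ^ 2)) := by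
    intro a ha
    rw [hm]
    exact intervalIntegral.integral_mono_interval (by linarith) (by linarith) ha
      (Filter.Eventually.of_forall fun x => (Real.exp_pos _).le) (hi _ _)
  induction k with
  | zero =>
    refine ⟨1, one_pos, fun a ha => ?_⟩
    have := (hm0.trans_le (hJ a ha)).ne'
    simp [div_self this]
    positivity
  | succ k ih =>
    obtain ⟨C, hC, ih⟩ := ih
    refine ⟨(2 * k + 1) * C + 2 * σ ^ 2 / m, by positivity, fun a ha => ?_⟩
    specialize ih a ha
    specialize hJ a ha
    rw [aux_rec σ hσ, Finset.prod_range_succ]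
    set J := ∫ x in (-a)..a, Real.exp (-x ^ 2 / (2 * σ ^ 2))
    set I := ∫ x in (-a)..a, x ^ (2 * k) * Real.exp (-x ^ 2 / (2 * σ ^ 2))
    set P := ∏ i ∈ Finset.range k, (2 * (i : ℝ) + 1)
    set e := Real.exp (-a ^ 2 / (2 * σ ^ 2))
    have he : 0 < e := Real.exp_pos _
    have hJ0 : 0 < J := hm0.trans_le hJ
    have ha0 : 0 < a := hσ.trans_le ha
    have key : (σ ^ 2 * (2 * (k : ℝ) + 1) * I - 2 * σ ^ 2 * a ^ (2 * k + 1) * e) / J -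
        σ ^ (2 * (k + 1)) * (P * (2 * (k : ℝ) + 1)) =
        σ ^ 2 * (2 * (k : ℝ) + 1) * (I / J - σ ^ (2 * k) * P)
          - 2 * σ ^ 2 / J * (a ^ (2 * k + 1) * e) := by
      field_simp
      ring
    rw [key]
    have hB : 2 * σ ^ 2 / J ≤ 2 * σ ^ 2 / m := by gcongr
    have hs : σ ^ 2 ≤ a ^ 2 := by gcongr
    calc _ ≤ (|σ ^ 2 * (2 * (k : ℝ) + 1) * (I / J - σ ^ (2 * k) * P)|
          + |2 * σ ^ 2 / J * (a ^ (2 * k + 1) * e)|) * a := by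
            gcongr
            exact abs_sub _ _
      _ = σ ^ 2 * (2 * (k : ℝ) + 1) * (|I / J - σ ^ (2 * k) * P| * a)
          + 2 * σ ^ 2 / J * (a ^ (2 * k + 1) * e) * a := by
            rw [abs_mul, abs_of_pos (show 0 < σ ^ 2 * (2 * (k : ℝ) + 1) by positivity),
              abs_of_pos (show 0 < 2 * σ ^ 2 / J * (a ^ (2 * k + 1) * e) by positivity)]
            ring
      _ ≤ a ^ 2 * (2 * (k : ℝ) + 1) * (C * a ^ (2 * k) * e)
          + 2 * σ ^ 2 / m * (a ^ (2 * k + 1) * e) * a := by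
            gcongr
      _ = _ := by ring

/-- Conditional even moments of a centered Gaussian given `{−a ≤ X ≤ a}` are
`σ^{2k} (2k−1)!!` up to an error `O(a^{2k−1} exp(−a²/(2σ²)))`. -/
theorem conditional_even_moment_gaussian_approx (σ : ℝ) (hσ : 0 < σ) (k : ℕ) (hk : 1 ≤ k) :
    ∃ C : ℝ, 0 < C ∧ ∀ a : ℝ, σ ≤ a →
      |(∫ x in Icc (-a) a, x ^ (2 * k) ∂(gaussianReal 0 ⟨σ ^ 2, sq_nonneg σ⟩)) /
            ((gaussianReal 0 ⟨σ ^ 2, sq_nonneg σ⟩) (Icc (-a) a)).toReal -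
          σ ^ (2 * k) * ∏ i ∈ Finset.range k, (2 * (i : ℝ) + 1)| ≤
        C * a ^ (2 * k - 1) * Real.exp (-a ^ 2 / (2 * σ ^ 2)) := by
  obtain ⟨C, hC, h⟩ := aux_ratio σ hσ k
  refine ⟨C, hC, fun a ha => ?_⟩
  specialize h a ha
  have ha0 : 0 < a := hσ.trans_le ha
  have hv : (⟨σ ^ 2, sq_nonneg σ⟩ : NNReal) ≠ 0 := by
    intro h0
    have := congrArg NNReal.toReal h0
    exact (pow_pos hσ 2).ne' this
  obtain ⟨c, hc⟩ : ∃ c, c = (√(2 * π * σ ^ 2))⁻¹ := ⟨_, rfl⟩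
  have hc0 : 0 < c := by rw [hc]; positivity
  have hpdf : ∀ x, gaussianPDFReal 0 ⟨σ ^ 2, sq_nonneg σ⟩ x
      = c * Real.exp (-x ^ 2 / (2 * σ ^ 2)) := by
    intro x
    have hq : ∀ v : NNReal, (v : ℝ) = σ ^ 2 →
        gaussianPDFReal 0 v x = c * Real.exp (-x ^ 2 / (2 * σ ^ 2)) := by
      intro v hv
      rw [gaussianPDFReal_def, hc, hv]
      simp only [sub_zero]
    exact hq _ rfl
  have hgen : ∀ f : ℝ → ℝ, ∫ x in Icc (-a) a, f x ∂(gaussianReal 0 ⟨σ ^ 2, sq_nonneg σ⟩)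
      = c * ∫ x in (-a)..a, f x * Real.exp (-x ^ 2 / (2 * σ ^ 2)) := by
    intro f
    rw [← integral_indicator measurableSet_Icc, integral_gaussianReal_eq_integral_smul hv,
      intervalIntegral.integral_of_le (by linarith), ← integral_Icc_eq_integral_Ioc,
      ← integral_const_mul, ← integral_indicator measurableSet_Icc]
    congr 1
    ext x
    by_cases hx : x ∈ Icc (-a) a
    · simp only [indicator_of_mem hx, hpdf, smul_eq_mul]; ring
    · simp [indicator_of_notMem hx]
  have hden : ((gaussianReal 0 ⟨σ ^ 2, sq_nonneg σ⟩) (Icc (-a) a)).toReal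
      = c * ∫ x in (-a)..a, Real.exp (-x ^ 2 / (2 * σ ^ 2)) := by
    have := hgen (fun _ => 1)
    simpa [Measure.real] using this
  rw [hgen, hden, mul_div_mul_left _ _ hc0.ne']
  have e : a ^ (2 * k) = a ^ (2 * k - 1) * a := by
    rw [← pow_succ]; congr 1; omega
  rw [e] at h
  refine le_of_mul_le_mul_right (h.trans_eq ?_) ha0
  ring
end

section
/- Fix σ > 0 and an integer k ≥ 1. For m > 1 let ν_m be the Gaussian measure on ℝ with mean m and variance σ² and let S_m = [1, 2m−1]. Then there exist constants C > 0 and M > 1 such that for all m ≥ M, the conditional expectation of the reciprocal satisfies | (∫_{S_m} (1/x) dν_m(x)) / ν_m(S_m) − (1/m) ∑_{j=0}^{k} (2j−1)!! · σ^{2j} / m^{2j} | ≤ C · σ^{2k+2} / m^{2k+2}. -/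
open MeasureTheory ProbabilityTheory Real Set Finset

namespace GaussTaylor

open scoped NNReal

lemma integrable_pow_gauss (v : ℝ≥0) (n : ℕ) :
    Integrable (fun y : ℝ => y ^ n) (gaussianReal 0 v) := by
  have h := (memLp_id_gaussianReal' (μ := 0) (v := v) (n : ENNReal) (by simp)).integrable_norm_pow'
  have h2 : Integrable (fun y : ℝ => ‖y ^ n‖) (gaussianReal 0 v) := by
    simpa [norm_pow] using h
  exact (integrable_norm_iff (by fun_prop)).1 h2

lemma integrable_pow_pdf (v : ℝ≥0) (hv : v ≠ 0) (n : ℕ) :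
    Integrable (fun y : ℝ => y ^ n * gaussianPDFReal 0 v y) := by
  have h := integrable_pow_gauss v n
  rw [gaussianReal_of_var_ne_zero _ hv,
    integrable_withDensity_iff_integrable_smul' (measurable_gaussianPDF 0 v)
      (by simp [gaussianPDF_lt_top])] at h
  simpa [toReal_gaussianPDF, mul_comm] using h

lemma hasDerivAt_pdf (v : ℝ≥0) (hv : v ≠ 0) (y : ℝ) :
    HasDerivAt (gaussianPDFReal 0 v) (-(y / v) * gaussianPDFReal 0 v y) y := by
  have hv' : (v : ℝ) ≠ 0 := by simpa using hv
  have h : HasDerivAt (fun x : ℝ => (√(2 * π * v))⁻¹ * rexp (-(x - 0) ^ 2 / (2 * v)))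
      ((√(2 * π * v))⁻¹ * (rexp (-(y - 0) ^ 2 / (2 * v)) * (-(2 * (y - 0)) / (2 * v)))) y := by
    have h1 : HasDerivAt (fun x : ℝ => -(x - 0) ^ 2 / (2 * v)) (-(2 * (y - 0)) / (2 * v)) y := by
      have := ((((hasDerivAt_id y).sub_const 0).pow 2).neg).div_const (2 * (v : ℝ))
      simpa using this
    exact (h1.exp).const_mul _
  have e : gaussianPDFReal 0 v
      = (fun x : ℝ => (√(2 * π * v))⁻¹ * rexp (-(x - 0) ^ 2 / (2 * v))) := rfl
  rw [e]
  convert h using 1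
  field_simp
  simp

lemma moment_rec (v : ℝ≥0) (hv : v ≠ 0) (n : ℕ) :
    ∫ y, y ^ (n + 2) ∂(gaussianReal 0 v) = (n + 1) * v * ∫ y, y ^ n ∂(gaussianReal 0 v) := by
  have hv' : (v : ℝ) ≠ 0 := by simpa using hv
  rw [integral_gaussianReal_eq_integral_smul hv, integral_gaussianReal_eq_integral_smul hv]
  have key := integral_mul_deriv_eq_deriv_mul_of_integrable
    (u := fun y : ℝ => y ^ (n + 1)) (u' := fun y : ℝ => (n + 1) * y ^ n)
    (v := gaussianPDFReal 0 v) (v' := fun y => -(y / v) * gaussianPDFReal 0 v y)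
    (fun y _ => by simpa using hasDerivAt_pow (n + 1) y)
    (fun y _ => hasDerivAt_pdf v hv y)
    (by
      refine ((integrable_pow_pdf v hv (n + 2)).const_mul (-(1 / (v : ℝ)))).congr
        (Filter.Eventually.of_forall fun y => ?_)
      simp only [Pi.mul_apply]; ring)
    (by
      refine ((integrable_pow_pdf v hv n).const_mul ((n : ℝ) + 1)).congr
        (Filter.Eventually.of_forall fun y => ?_)
      simp only [Pi.mul_apply]; ring)
    (integrable_pow_pdf v hv (n + 1))
  have e1 : ∫ y, y ^ (n + 1) * (-(y / v) * gaussianPDFReal 0 v y)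
      = -(1 / (v : ℝ)) * ∫ y, gaussianPDFReal 0 v y • y ^ (n + 2) := by
    rw [← integral_const_mul]
    congr 1; ext y; simp only [smul_eq_mul]; ring
  have e2 : ∫ y, ((n : ℝ) + 1) * y ^ n * gaussianPDFReal 0 v y
      = ((n : ℝ) + 1) * ∫ y, gaussianPDFReal 0 v y • y ^ n := by
    rw [← integral_const_mul]
    congr 1; ext y; simp only [smul_eq_mul]; ring
  rw [e1, e2] at key
  field_simp at key
  linarith

lemma moment_even (v : ℝ≥0) (hv : v ≠ 0) (j : ℕ) :
    ∫ y, y ^ (2 * j) ∂(gaussianReal 0 v)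
      = (∏ i ∈ Finset.range j, (2 * (i : ℝ) + 1)) * (v : ℝ) ^ j := by
  induction j with
  | zero => simp
  | succ j ih =>
    rw [show 2 * (j + 1) = 2 * j + 2 by ring, moment_rec v hv, ih, Finset.prod_range_succ]
    push_cast; ring

lemma moment_odd (v : ℝ≥0) (hv : v ≠ 0) (j : ℕ) :
    ∫ y, y ^ (2 * j + 1) ∂(gaussianReal 0 v) = 0 := by
  induction j with
  | zero => simp [integral_id_gaussianReal]
  | succ j ih =>
    rw [show 2 * (j + 1) + 1 = (2 * j + 1) + 2 by ring, moment_rec v hv, ih]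
    simp

lemma taylor_rem (m y : ℝ) (hm : 0 < m) (hy : 1 ≤ y + m) (n : ℕ) :
    |1 / (y + m) - (1 / m) * ∑ i ∈ Finset.range (2 * n), (-y / m) ^ i|
      ≤ y ^ (2 * n) / m ^ (2 * n) := by
  have h := mul_neg_geom_sum (-y / m) (2 * n)
  have h0 : y + m ≠ 0 := by linarith
  have e : 1 / (y + m) - (1 / m) * ∑ i ∈ Finset.range (2 * n), (-y / m) ^ i
      = (y ^ (2 * n) / m ^ (2 * n)) / (y + m) := by
    have h1 : (-y / m) ^ (2 * n) = y ^ (2 * n) / m ^ (2 * n) := by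
      rw [div_pow, (even_two_mul n).neg_pow]
    rw [h1] at h
    rw [eq_div_iff h0]
    have h2 : (1 / m) * (y + m) = 1 - -y / m := by field_simp; ring
    calc _ = 1 / (y + m) * (y + m)
          - ((1 / m) * (y + m)) * ∑ i ∈ Finset.range (2 * n), (-y / m) ^ i := by ring
      _ = _ := by rw [h2, h, one_div_mul_cancel h0]; ring
  have hp : 0 ≤ y ^ (2 * n) / m ^ (2 * n) :=
    div_nonneg ((even_two_mul n).pow_nonneg y) (by positivity)
  rw [e, abs_of_nonneg (div_nonneg hp (by linarith))]
  exact div_le_self hp hy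

/-- the approximating polynomial -/
noncomputable def F (m : ℝ) (n : ℕ) (y : ℝ) : ℝ :=
  (1 / m) * ∑ i ∈ Finset.range (2 * n), (-y / m) ^ i

lemma integrable_F (v : ℝ≥0) (m : ℝ) (n : ℕ) : Integrable (F m n) (gaussianReal 0 v) := by
  unfold F
  refine (integrable_finsetSum _ fun i _ => ?_).const_mul _
  refine ((integrable_pow_gauss v i).const_mul ((-1 / m) ^ i)).congr
    (Filter.Eventually.of_forall fun y => ?_)
  simp only [← mul_pow]; ring

lemma integral_F (v : ℝ≥0) (hv : v ≠ 0) (m : ℝ) (n : ℕ) :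
    ∫ y, F m n y ∂(gaussianReal 0 v) = (1 / m) * ∑ j ∈ Finset.range n,
      (∏ i ∈ Finset.range j, (2 * (i : ℝ) + 1)) * (v : ℝ) ^ j / m ^ (2 * j) := by
  unfold F
  have hi : ∀ i : ℕ, (fun y : ℝ => (-y / m) ^ i) = fun y : ℝ => (-1 / m) ^ i * y ^ i := by
    intro i; ext y; rw [← mul_pow]; ring
  rw [integral_const_mul, integral_finsetSum _ (fun i _ => by
    rw [hi]; exact (integrable_pow_gauss v i).const_mul _)]
  congr 1
  simp_rw [hi, integral_const_mul]
  induction n with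
  | zero => simp
  | succ n ih =>
    rw [show 2 * (n + 1) = 2 * n + 1 + 1 by ring, Finset.sum_range_succ, Finset.sum_range_succ, ih,
      Finset.sum_range_succ, moment_odd v hv, moment_even v hv, div_pow,
      (even_two_mul n).neg_pow]
    simp; ring

lemma abs_F_le (m y : ℝ) (hm : 1 ≤ m) (n : ℕ) :
    |F m n y| ≤ ∑ i ∈ Finset.range (2 * n), |y ^ i| := by
  unfold F
  have hm0 : 0 < m := by linarith
  rw [abs_mul]
  have h1 : |1 / m| ≤ 1 := by
    rw [abs_of_pos (by positivity)]; exact (div_le_one hm0).2 hm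
  calc |1 / m| * |∑ i ∈ Finset.range (2 * n), (-y / m) ^ i|
      ≤ 1 * ∑ i ∈ Finset.range (2 * n), |y ^ i| := by
        refine mul_le_mul h1 ((Finset.abs_sum_le_sum_abs _ _).trans
          (Finset.sum_le_sum fun i _ => ?_)) (abs_nonneg _) zero_le_one
        rw [div_pow, abs_div, abs_pow, abs_neg, abs_pow, abs_pow, abs_of_pos hm0]
        exact div_le_self (by positivity) (one_le_pow₀ hm)
    _ = _ := one_mul _

lemma main (v : ℝ≥0) (hv : v ≠ 0) (n : ℕ) (hn : 1 ≤ n) :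
    ∃ C : ℝ, 0 < C ∧ ∃ M : ℝ, 1 < M ∧ ∀ m : ℝ, M ≤ m →
      |(∫ x in Icc 1 (2 * m - 1), (1 / x) ∂(gaussianReal m v)) /
            ((gaussianReal m v) (Icc 1 (2 * m - 1))).toReal -
          ∫ y, F m n y ∂(gaussianReal 0 v)| ≤ C / m ^ (2 * n) := by
  set μ := gaussianReal 0 v with hμ
  set S : ℝ → ℝ := fun y => ∑ i ∈ Finset.range (2 * n), |y ^ i| with hS
  have hSi : Integrable S μ := integrable_finsetSum _ fun i _ => (integrable_pow_gauss v i).abs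
  set B := ∫ y, S y ∂μ with hB
  have hS0 : ∀ y, 0 ≤ S y := fun y => Finset.sum_nonneg fun i _ => abs_nonneg _
  have hB0 : 0 ≤ B := integral_nonneg hS0
  -- dominating functions
  have hP : Integrable (fun y : ℝ => y ^ (2 * n)) μ := integrable_pow_gauss v _
  have hQ : Integrable (fun y : ℝ => (2 * y) ^ (2 * n)) μ := by
    simp_rw [mul_pow]; exact hP.const_mul _
  have hR : Integrable (fun y : ℝ => (2 * y) ^ (2 * n) * (S y + B)) μ := by
    simp_rw [mul_add]
    refine Integrable.add ?_ (hQ.mul_const _)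
    simp_rw [hS, Finset.mul_sum]
    refine integrable_finsetSum _ fun i _ => ?_
    refine ((integrable_pow_gauss v (2 * n + i)).abs.const_mul (2 ^ (2 * n))).congr
      (Filter.Eventually.of_forall fun y => ?_)
    simp only [mul_pow, pow_add, abs_mul, abs_of_nonneg ((even_two_mul n).pow_nonneg y)]; ring
  have hev : ∀ y : ℝ, 0 ≤ y ^ (2 * n) := fun y => (even_two_mul n).pow_nonneg y
  set C1 := ∫ y, y ^ (2 * n) ∂μ with hC1
  set C2 := ∫ y, (2 * y) ^ (2 * n) * (S y + B) ∂μ with hC2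
  set C3 := ∫ y, (2 * y) ^ (2 * n) ∂μ with hC3
  have h1 : 0 ≤ C1 := integral_nonneg hev
  have h2 : 0 ≤ C2 := integral_nonneg fun y => mul_nonneg (hev _) (add_nonneg (hS0 y) hB0)
  have h3 : 0 ≤ C3 := integral_nonneg fun y => hev _
  refine ⟨2 * (C1 + C2) + 1, by positivity, 2 + 2 * C3, by linarith, fun m hm => ?_⟩
  have hm2 : 2 ≤ m := by linarith
  have hm0 : 0 < m := by linarith
  have hmN : 0 < m ^ (2 * n) := by positivity
  set T : Set ℝ := (fun y => y + m) ⁻¹' Icc 1 (2 * m - 1) with hT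
  have hTm : MeasurableSet T := measurableSet_Icc.preimage (by fun_prop)
  have hmap : gaussianReal m v = μ.map (fun y => y + m) := by
    rw [hμ, gaussianReal_map_add_const, zero_add]
  have hI : ∫ x in Icc 1 (2 * m - 1), (1 / x) ∂(gaussianReal m v) = ∫ y in T, 1 / (y + m) ∂μ := by
    rw [hmap, setIntegral_map measurableSet_Icc (by fun_prop) (by fun_prop)]
  have hp : ((gaussianReal m v) (Icc 1 (2 * m - 1))).toReal = μ.real T := by
    rw [hmap, Measure.map_apply (by fun_prop) measurableSet_Icc]; rfl
  rw [hI, hp]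
  set A := ∫ y, F m n y ∂μ with hA
  have hFi : Integrable (F m n) μ := integrable_F v m n
  have hAB : |A| ≤ B := by
    refine (abs_integral_le_integral_abs).trans ?_
    exact integral_mono hFi.abs hSi fun y => abs_F_le m y (by linarith) n
  have hTc : ∀ y ∈ Tᶜ, 1 ≤ (2 * y) ^ (2 * n) / m ^ (2 * n) := by
    intro y hy
    have hy' : m ≤ |2 * y| := by
      by_contra hlt
      push Not at hlt
      rw [abs_lt] at hlt
      apply hy
      simp only [hT, Set.mem_preimage, Set.mem_Icc]
      constructor <;> linarith
    rw [le_div_iff₀ hmN, one_mul, ← (even_two_mul n).pow_abs (2 * y)]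
    exact pow_le_pow_left₀ hm0.le hy' _
  -- probability bound
  have hpc : μ.real Tᶜ ≤ C3 / m ^ (2 * n) := by
    have : μ.real Tᶜ = ∫ y in Tᶜ, (1 : ℝ) ∂μ := by simp
    rw [this, hC3, ← integral_div]
    refine (setIntegral_mono_on (integrable_const _).integrableOn (hQ.div_const _).integrableOn
      hTm.compl hTc).trans ?_
    exact setIntegral_le_integral (hQ.div_const _)
      (Filter.Eventually.of_forall fun y => div_nonneg (hev _) hmN.le)
  have hphalf : 1 / 2 ≤ μ.real T := by
    have e := probReal_compl_eq_one_sub (μ := μ) hTm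
    have : C3 / m ^ (2 * n) ≤ 1 / 2 := by
      rw [div_le_iff₀ hmN]
      have : m ≤ m ^ (2 * n) := le_self_pow₀ (by linarith) (by omega)
      linarith
    linarith
  have hppos : 0 < μ.real T := by linarith
  have hTI : IntegrableOn (fun y => 1 / (y + m)) T μ := by
    refine Integrable.mono' (integrable_const (1 : ℝ))
      (Measurable.aestronglyMeasurable (by fun_prop)) ?_
    refine (ae_restrict_mem hTm).mono fun y hy => ?_
    have hy1 : 1 ≤ y + m := hy.1
    rw [Real.norm_of_nonneg (by positivity)]
    exact (div_le_one (by linarith)).2 hy1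
  have b1 : |∫ y in T, (1 / (y + m) - F m n y) ∂μ| ≤ C1 / m ^ (2 * n) := by
    refine (abs_integral_le_integral_abs).trans ?_
    rw [hC1, ← integral_div]
    refine (setIntegral_mono_on (hTI.sub hFi.integrableOn).abs (hP.div_const _).integrableOn
      hTm fun y hy => taylor_rem m y hm0 hy.1 n).trans ?_
    exact setIntegral_le_integral (hP.div_const _)
      (Filter.Eventually.of_forall fun y => div_nonneg (hev _) hmN.le)
  have hGi : Integrable (fun y => F m n y - A) μ := hFi.sub (integrable_const _)
  have b2 : |∫ y in T, (F m n y - A) ∂μ| ≤ C2 / m ^ (2 * n) := by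
    have e0 : ∫ y, (F m n y - A) ∂μ = 0 := by
      rw [integral_sub hFi (integrable_const _)]; simp [hA]
    have e1 := integral_add_compl hTm hGi
    have e2 : ∫ y in T, (F m n y - A) ∂μ = -∫ y in Tᶜ, (F m n y - A) ∂μ := by linarith
    rw [e2, abs_neg]
    refine (abs_integral_le_integral_abs).trans ?_
    rw [hC2, ← integral_div]
    refine (setIntegral_mono_on hGi.abs.integrableOn (hR.div_const (m ^ (2 * n))).integrableOn
      hTm.compl fun y hy => ?_).trans ?_
    · have hb : |F m n y - A| ≤ S y + B :=
        (abs_sub _ _).trans (add_le_add (abs_F_le m y (by linarith) n) hAB)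
      have := le_mul_of_one_le_left (add_nonneg (hS0 y) hB0) (hTc y hy)
      calc _ ≤ _ := hb
        _ ≤ _ := this
        _ = _ := by ring
    · exact setIntegral_le_integral (hR.div_const _)
        (Filter.Eventually.of_forall fun y =>
          div_nonneg (mul_nonneg (hev _) (add_nonneg (hS0 y) hB0)) hmN.le)
  have split : (∫ y in T, 1 / (y + m) ∂μ) - μ.real T * A
      = (∫ y in T, (1 / (y + m) - F m n y) ∂μ) + ∫ y in T, (F m n y - A) ∂μ := by
    rw [integral_sub hTI hFi.integrableOn,
      integral_sub hFi.integrableOn (integrable_const _).integrableOn]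
    simp
  have e : (∫ y in T, 1 / (y + m) ∂μ) / μ.real T - A
      = ((∫ y in T, 1 / (y + m) ∂μ) - μ.real T * A) / μ.real T := by
    field_simp
  rw [e, abs_div, abs_of_pos hppos, div_le_iff₀ hppos, split]
  have b3 : (C1 + C2) / m ^ (2 * n) ≤ (2 * (C1 + C2) + 1) / m ^ (2 * n) * μ.real T := by
    rw [div_mul_eq_mul_div]
    apply div_le_div_of_nonneg_right _ hmN.le
    nlinarith
  refine (abs_add_le _ _).trans ((add_le_add b1 b2).trans ?_)
  rw [← add_div]; exact b3

lemma main2 (σ : ℝ) (hσ : 0 < σ) (k : ℕ) (v : ℝ≥0) (hc : (v : ℝ) = σ ^ 2) :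
    ∃ C : ℝ, 0 < C ∧ ∃ M : ℝ, 1 < M ∧ ∀ m : ℝ, M ≤ m →
      |(∫ x in Icc 1 (2 * m - 1), (1 / x) ∂(gaussianReal m v)) /
            ((gaussianReal m v) (Icc 1 (2 * m - 1))).toReal -
          (1 / m) * ∑ j ∈ Finset.range (k + 1),
            (∏ i ∈ Finset.range j, (2 * (i : ℝ) + 1)) * σ ^ (2 * j) / m ^ (2 * j)| ≤
        C * σ ^ (2 * k + 2) / m ^ (2 * k + 2) := by
  have hv : v ≠ 0 := by
    rintro rfl
    exact (pow_pos hσ 2).ne hc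
  obtain ⟨C, hC, M, hM, h⟩ := main _ hv (k + 1) (by omega)
  have hs : 0 < σ ^ (2 * k + 2) := by positivity
  refine ⟨C / σ ^ (2 * k + 2), by positivity, M, hM, fun m hm => ?_⟩
  have := h m hm
  rw [integral_F _ hv] at this
  rw [div_mul_cancel₀ _ hs.ne']
  simpa only [hc, ← pow_mul, mul_add, mul_one] using this

end GaussTaylor

/-- Taylor expansion of the conditional mean of the reciprocal of a Gaussian `N(m, σ²)`
given `S_m = [1, 2m−1]`:
`E[1/X | S_m] = (1/m) ∑_{j=0}^k (2j−1)!! σ^{2j}/m^{2j} + O(σ^{2k+2}/m^{2k+2})`. -/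
theorem conditional_mean_reciprocal_gaussian_taylor (σ : ℝ) (hσ : 0 < σ) (k : ℕ) (hk : 1 ≤ k) :
    ∃ C : ℝ, 0 < C ∧ ∃ M : ℝ, 1 < M ∧ ∀ m : ℝ, M ≤ m →
      |(∫ x in Icc 1 (2 * m - 1), (1 / x) ∂(gaussianReal m ⟨σ ^ 2, sq_nonneg σ⟩)) /
            ((gaussianReal m ⟨σ ^ 2, sq_nonneg σ⟩) (Icc 1 (2 * m - 1))).toReal -
          (1 / m) * ∑ j ∈ Finset.range (k + 1),
            (∏ i ∈ Finset.range j, (2 * (i : ℝ) + 1)) * σ ^ (2 * j) / m ^ (2 * j)| ≤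
        C * σ ^ (2 * k + 2) / m ^ (2 * k + 2) := by
  exact GaussTaylor.main2 σ hσ k _ rfl
end

section
/- Fix σ > 0 and an integer k ≥ 1. For m > 1 let ν_m be the Gaussian measure on ℝ with mean m and variance σ² and let S_m = [1, 2m−1]. Then there exist constants C > 0 and M > 1 such that for all m ≥ M, the conditional second moment of the reciprocal satisfies | (∫_{S_m} (1/x²) dν_m(x)) / ν_m(S_m) − (1/m²) ∑_{j=0}^{k} (2j+1)!! · σ^{2j} / m^{2j} | ≤ C · σ^{2k+2} / m^{2k+2}. -/
open MeasureTheory ProbabilityTheory Real Set Finset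

/-- integrability of moments -/
lemma gm_int (v : NNReal) (n : ℕ) : Integrable (fun y : ℝ => y ^ n) (gaussianReal 0 v) :=
  integrable_pow_of_mem_interior_integrableExpSet (X := id) (by simp [integrableExpSet_id_gaussianReal]) n

lemma gm_int_abs (v : NNReal) (n : ℕ) : Integrable (fun y : ℝ => |y| ^ n) (gaussianReal 0 v) :=
  integrable_pow_abs_of_mem_interior_integrableExpSet (X := id) (by simp [integrableExpSet_id_gaussianReal]) n

lemma gm_int_pdf (v : NNReal) (hv : v ≠ 0) (n : ℕ) :
    Integrable (fun y : ℝ => y ^ n * gaussianPDFReal 0 v y) := by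
  have h := gm_int v n
  rw [gaussianReal_of_var_ne_zero _ hv,
    integrable_withDensity_iff_integrable_smul' (measurable_gaussianPDF 0 v) (by simp [gaussianPDF])] at h
  refine h.congr (Filter.Eventually.of_forall fun y => ?_)
  simp [toReal_gaussianPDF, mul_comm]

lemma gm_rec (v : NNReal) (hv : v ≠ 0) (n : ℕ) :
    ∫ y, y ^ (n + 2) ∂(gaussianReal 0 v) = (n + 1) * v * ∫ y, y ^ n ∂(gaussianReal 0 v) := by
  have hv' : (v : ℝ) ≠ 0 := by exact_mod_cast hv
  rw [integral_gaussianReal_eq_integral_smul hv, integral_gaussianReal_eq_integral_smul hv]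
  have hd : ∀ y : ℝ, HasDerivAt (fun y => gaussianPDFReal 0 v y)
      (-(y / v) * gaussianPDFReal 0 v y) y := by
    intro y
    unfold gaussianPDFReal
    have h1 : HasDerivAt (fun y : ℝ => -(y - 0) ^ 2 / (2 * (v : ℝ))) (-(y / v)) y := by
      have := (((hasDerivAt_id y).sub_const 0).pow 2).neg.div_const (2 * (v : ℝ))
      refine this.congr_deriv ?_
      simp; field_simp
    have := (h1.exp).const_mul (√(2 * π * v))⁻¹
    refine this.congr_deriv ?_
    ring
  have hu : ∀ y : ℝ, HasDerivAt (fun y : ℝ => y ^ (n + 1)) ((n + 1) * y ^ n) y := by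
    intro y
    have := hasDerivAt_pow (n + 1) y
    simpa using this
  have key := integral_mul_deriv_eq_deriv_mul_of_integrable
    (fun y _ => hu y) (fun y _ => hd y)
    (by
      have := (gm_int_pdf v hv (n + 2)).const_mul (-(v : ℝ)⁻¹)
      refine this.congr (Filter.Eventually.of_forall fun y => ?_)
      simp; ring)
    (by
      have := (gm_int_pdf v hv n).const_mul ((n : ℝ) + 1)
      refine this.congr (Filter.Eventually.of_forall fun y => ?_)
      simp; ring)
    (by
      have := (gm_int_pdf v hv (n + 1))
      refine this.congr (Filter.Eventually.of_forall fun y => ?_)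
      simp)
  have e1 : ∫ y, gaussianPDFReal 0 v y • y ^ (n + 2)
      = -(v : ℝ) * ∫ y, y ^ (n + 1) * (-(y / v) * gaussianPDFReal 0 v y) := by
    rw [← integral_const_mul]
    congr 1; ext y; simp only [smul_eq_mul]; field_simp; ring
  have e2 : ∫ y, (n + 1) * y ^ n * gaussianPDFReal 0 v y
      = (n + 1) * ∫ y, gaussianPDFReal 0 v y • y ^ n := by
    rw [← integral_const_mul]
    congr 1; ext y; simp; ring
  rw [e1, key, e2]; ring

lemma gm_odd (v : NNReal) (hv : v ≠ 0) (j : ℕ) : ∫ y, y ^ (2 * j + 1) ∂(gaussianReal 0 v) = 0 := by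
  induction j with
  | zero => simp
  | succ j ih =>
    rw [show 2 * (j + 1) + 1 = (2 * j + 1) + 2 by ring, gm_rec v hv, ih, mul_zero]

lemma gm_even (v : NNReal) (hv : v ≠ 0) (j : ℕ) :
    (2 * (j : ℝ) + 1) * ∫ y, y ^ (2 * j) ∂(gaussianReal 0 v)
      = (∏ i ∈ Finset.range (j + 1), (2 * (i : ℝ) + 1)) * (v : ℝ) ^ j := by
  induction j with
  | zero => simp
  | succ j ih =>
    rw [show 2 * (j + 1) = (2 * j) + 2 by ring, gm_rec v hv, Finset.prod_range_succ]
    push_cast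
    rw [show ((2 * (j : ℝ) + 1) * v * ∫ y, y ^ (2 * j) ∂(gaussianReal 0 v)) =
      v * ((2 * (j : ℝ) + 1) * ∫ y, y ^ (2 * j) ∂(gaussianReal 0 v)) by ring, ih]
    ring

/-- Taylor polynomial -/
noncomputable def tayP (n : ℕ) (m y : ℝ) : ℝ :=
  ∑ i ∈ Finset.range n, ((-1) ^ i * ((i : ℝ) + 1) / m ^ (i + 2)) * y ^ i

lemma tayP_rem (n : ℕ) (m y : ℝ) (hm : m ≠ 0) (hx : y + m ≠ 0) :
    1 / (y + m) ^ 2 - tayP n m y = (-1) ^ n * (y / m) ^ n * (n + 1 + n * (y / m)) / (y + m) ^ 2 := by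
  induction n with
  | zero => simp [tayP]
  | succ n ih =>
    have : tayP (n + 1) m y = tayP n m y + ((-1) ^ n * ((n : ℝ) + 1) / m ^ (n + 2)) * y ^ n := by
      simp [tayP, Finset.sum_range_succ]
    rw [this, ← sub_sub, ih, div_pow, div_pow]
    push_cast
    field_simp
    ring

lemma tayP_integrable (v : NNReal) (n : ℕ) (m : ℝ) : Integrable (tayP n m) (gaussianReal 0 v) := by
  unfold tayP
  exact integrable_finsetSum _ fun i _ => (gm_int v i).const_mul _

lemma sum_range_two_mul' (f : ℕ → ℝ) (n : ℕ) :
    ∑ i ∈ Finset.range (2 * n), f i = ∑ j ∈ Finset.range n, (f (2 * j) + f (2 * j + 1)) := by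
  induction n with
  | zero => simp
  | succ n ih =>
    rw [show 2 * (n + 1) = 2 * n + 1 + 1 by ring, Finset.sum_range_succ, Finset.sum_range_succ, ih,
      Finset.sum_range_succ]; ring

lemma tayP_integral (σ : ℝ) (v : NNReal) (hv : v ≠ 0) (hvσ : (v : ℝ) = σ ^ 2) (k : ℕ) (m : ℝ) :
    ∫ y, tayP (2 * (k + 1)) m y ∂(gaussianReal 0 v) =
      (1 / m ^ 2) * ∑ j ∈ Finset.range (k + 1),
            (∏ i ∈ Finset.range (j + 1), (2 * (i : ℝ) + 1)) * σ ^ (2 * j) / m ^ (2 * j) := by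
  unfold tayP
  rw [integral_finsetSum _ fun i _ => (gm_int _ i).const_mul _, sum_range_two_mul', Finset.mul_sum]
  refine Finset.sum_congr rfl fun j _ => ?_
  rw [integral_const_mul, integral_const_mul, gm_odd _ hv]
  have h := gm_even _ hv j
  rw [hvσ, ← pow_mul] at h
  rw [← h, pow_add m]
  simp [pow_mul]
  field_simp

lemma tayP_abs (n : ℕ) (m y : ℝ) (hm : 1 ≤ m) :
    |tayP n m y| ≤ ∑ i ∈ Finset.range n, ((i : ℝ) + 1) * |y| ^ i := by
  unfold tayP
  refine (Finset.abs_sum_le_sum_abs _ _).trans (Finset.sum_le_sum fun i _ => ?_)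
  rw [abs_mul, abs_div, abs_mul, abs_pow, abs_pow, abs_pow, abs_neg, abs_one, one_pow, one_mul,
    abs_of_nonneg (by positivity : (0 : ℝ) ≤ i + 1)]
  gcongr
  refine div_le_self (by positivity) (one_le_pow₀ ?_)
  exact hm.trans (le_abs_self m)

/-- tail bound by Markov -/
lemma tail_bound (γ : Measure ℝ) (g : ℝ → ℝ) (hg : ∀ y, 0 ≤ g y) (N : ℕ) (m : ℝ) (hm : 2 ≤ m)
    (hgi : Integrable g γ)
    (hi : Integrable (fun y => g y * |y| ^ N) γ) :
    ∫ y in (Icc (1 - m) (m - 1))ᶜ, g y ∂γ ≤ 2 ^ N * (∫ y, g y * |y| ^ N ∂γ) / m ^ N := by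
  have hm0 : 0 < m := by linarith
  have hs : MeasurableSet (Icc (1 - m) (m - 1))ᶜ := measurableSet_Icc.compl
  have hi' : Integrable (fun y => (2 ^ N / m ^ N) * (g y * |y| ^ N)) γ := hi.const_mul _
  calc ∫ y in (Icc (1 - m) (m - 1))ᶜ, g y ∂γ
      ≤ ∫ y in (Icc (1 - m) (m - 1))ᶜ, (2 ^ N / m ^ N) * (g y * |y| ^ N) ∂γ := by
        refine setIntegral_mono_on hgi.integrableOn hi'.integrableOn hs fun y hy => ?_
        have h1 : m / 2 ≤ |y| := by
          by_contra hc
          push Not at hc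
          rw [abs_lt] at hc
          exact hy ⟨by linarith, by linarith⟩
        have h2 : 1 ≤ (2 * |y| / m) ^ N := by
          apply one_le_pow₀
          rw [le_div_iff₀ hm0]; linarith
        calc g y ≤ g y * (2 * |y| / m) ^ N := le_mul_of_one_le_right (hg y) h2
          _ = _ := by rw [div_pow, mul_pow]; ring
    _ ≤ ∫ y, (2 ^ N / m ^ N) * (g y * |y| ^ N) ∂γ :=
        setIntegral_le_integral hi' (Filter.Eventually.of_forall fun y => by
          have := hg y
          simp only [Pi.zero_apply]; positivity)
    _ = _ := by rw [integral_const_mul]; ring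

lemma shift_integral (v : NNReal) (m : ℝ) :
    (∫ x in Icc 1 (2 * m - 1), (1 / x ^ 2) ∂(gaussianReal m v)) =
      ∫ y in Icc (1 - m) (m - 1), (1 / (y + m) ^ 2) ∂(gaussianReal 0 v) := by
  have h := gaussianReal_map_add_const (μ := 0) (v := v) m
  rw [zero_add] at h
  rw [← h, (measurableEmbedding_addRight m).setIntegral_map]
  congr 2
  ext y
  simp only [Set.mem_preimage, Set.mem_Icc]
  constructor <;> rintro ⟨a, b⟩ <;> constructor <;> linarith

lemma shift_measure (v : NNReal) (m : ℝ) :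
    gaussianReal m v (Icc 1 (2 * m - 1)) = gaussianReal 0 v (Icc (1 - m) (m - 1)) := by
  have h := gaussianReal_map_add_const (μ := 0) (v := v) m
  rw [zero_add] at h
  rw [← h, (measurableEmbedding_addRight m).map_apply]
  congr 1
  ext y
  simp only [Set.mem_preimage, Set.mem_Icc]
  constructor <;> rintro ⟨a, b⟩ <;> constructor <;> linarith

lemma main_aux (σ : ℝ) (hσ : 0 < σ) (v : NNReal) (hvσ : (v : ℝ) = σ ^ 2) (k : ℕ) :
    ∃ C : ℝ, 0 < C ∧ ∃ M : ℝ, 1 < M ∧ ∀ m : ℝ, M ≤ m →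
      |(∫ x in Icc 1 (2 * m - 1), (1 / x ^ 2) ∂(gaussianReal m v)) /
            ((gaussianReal m v) (Icc 1 (2 * m - 1))).toReal -
          (1 / m ^ 2) * ∑ j ∈ Finset.range (k + 1),
            (∏ i ∈ Finset.range (j + 1), (2 * (i : ℝ) + 1)) * σ ^ (2 * j) / m ^ (2 * j)| ≤
        C * σ ^ (2 * k + 2) / m ^ (2 * k + 2) := by
  have hv : v ≠ 0 := by
    rintro rfl
    have : σ ^ 2 = 0 := by simpa using hvσ.symm
    exact absurd this (by positivity)
  set γ := gaussianReal 0 v with hγ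
  set N := 2 * (k + 1) with hN
  set Q : ℝ → ℝ := fun y => ∑ i ∈ Finset.range N, ((i : ℝ) + 1) * |y| ^ i with hQ
  have hQ0 : ∀ y, 0 ≤ Q y := fun y => Finset.sum_nonneg fun i _ => by positivity
  have hQi : Integrable Q γ :=
    integrable_finsetSum _ fun i _ => (gm_int_abs v i).const_mul _
  set q := ∫ y, Q y ∂γ with hq
  have hq0 : 0 ≤ q := integral_nonneg hQ0
  have hgi : Integrable (fun y => Q y + q) γ := hQi.add (integrable_const _)
  have hgN : Integrable (fun y => (Q y + q) * |y| ^ N) γ := by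
    have h1 : Integrable (fun y => ∑ i ∈ Finset.range N, ((i : ℝ) + 1) * |y| ^ (i + N)) γ :=
      integrable_finsetSum _ fun i _ => (gm_int_abs v (i + N)).const_mul _
    refine (h1.add ((gm_int_abs v N).const_mul q)).congr (Filter.Eventually.of_forall fun y => ?_)
    simp only [hQ, Pi.add_apply, add_mul, Finset.sum_mul, pow_add, mul_assoc]
  set L := ∫ y, (Q y + q) * |y| ^ N ∂γ with hL
  have hL0 : 0 ≤ L := integral_nonneg fun y => by
    have := hQ0 y
    simp only [Pi.zero_apply]; positivity
  set A := ∫ y, |y| ^ N ∂γ with hA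
  have hA0 : 0 ≤ A := integral_nonneg fun y => by simp only [Pi.zero_apply]; positivity
  set B := ∫ y, |y| ^ 1 ∂γ with hB
  have hB0 : 0 ≤ B := integral_nonneg fun y => by simp only [Pi.zero_apply]; positivity
  set D := (2 * (N : ℝ) + 1) * A + 2 ^ N * L with hD
  have hD0 : 0 ≤ D := by positivity
  refine ⟨2 * (D + 1) / σ ^ (2 * k + 2), by positivity, 2 + 4 * B, by linarith, fun m hm => ?_⟩
  have hm2 : 2 ≤ m := by linarith
  have hm0 : 0 < m := by linarith
  rw [shift_integral, shift_measure, ← tayP_integral σ v hv hvσ k m]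
  rw [← hγ, ← hN]
  set S := Icc (1 - m) (m - 1) with hS
  have hSm : MeasurableSet S := measurableSet_Icc
  set P := tayP N m with hP
  have hPi : Integrable P γ := tayP_integrable v N m
  set e := ∫ y, P y ∂γ with he
  set p := (γ S).toReal with hp
  have hpr : p = γ.real S := rfl
  -- mass bound
  have hp2 : 1 / 2 ≤ p := by
    have h1 := tail_bound γ (fun _ => 1) (fun _ => zero_le_one) 1 m hm2 (integrable_const _)
      (by simpa using gm_int_abs v 1)
    rw [← hS, setIntegral_const, smul_eq_mul, mul_one] at h1
    simp only [one_mul] at h1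
    rw [← hB, measureReal_compl hSm, probReal_univ, ← hpr] at h1
    have h2 : 2 ^ 1 * B / m ^ 1 ≤ 1 / 2 := by
      rw [div_le_iff₀ (by positivity)]; linarith
    linarith
  have hp0 : 0 < p := by linarith
  -- bound of e
  have hPQ : ∀ y, |P y| ≤ Q y := fun y => tayP_abs N m y (by linarith)
  have heq : |e| ≤ q := by
    rw [he]
    exact (abs_integral_le_integral_abs).trans (integral_mono hPi.abs hQi hPQ)
  -- tail
  have htail : |∫ y in S, (P y - e) ∂γ| ≤ 2 ^ N * L / m ^ N := by
    have hPe : Integrable (fun y => P y - e) γ := hPi.sub (integrable_const _)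
    have h0 : ∫ y, (P y - e) ∂γ = 0 := by
      rw [integral_sub hPi (integrable_const _)]; simp [he]
    have h1 := integral_add_compl hSm hPe
    rw [h0] at h1
    rw [eq_neg_of_add_eq_zero_left h1, abs_neg]
    refine (abs_integral_le_integral_abs).trans (le_trans ?_
      (tail_bound γ (fun y => Q y + q) (fun y => add_nonneg (hQ0 y) hq0) N m hm2 hgi hgN))
    refine setIntegral_mono hPe.abs.integrableOn hgi.integrableOn fun y => ?_
    exact (abs_sub _ _).trans (add_le_add (hPQ y) heq)
  -- remainder
  have hf : IntegrableOn (fun y => 1 / (y + m) ^ 2) S γ := by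
    refine ContinuousOn.integrableOn_compact isCompact_Icc ?_
    refine ContinuousOn.div continuousOn_const (by fun_prop) fun y hy => ?_
    have : 1 ≤ y + m := by linarith [hy.1]
    positivity
  have hrem : |∫ y in S, (1 / (y + m) ^ 2 - P y) ∂γ| ≤ (2 * (N : ℝ) + 1) * A / m ^ N := by
    have hi : Integrable (fun y => ((2 * (N : ℝ) + 1) / m ^ N) * |y| ^ N) γ :=
      (gm_int_abs v N).const_mul _
    refine (abs_integral_le_integral_abs).trans ?_
    calc ∫ y in S, |1 / (y + m) ^ 2 - P y| ∂γ
        ≤ ∫ y in S, ((2 * (N : ℝ) + 1) / m ^ N) * |y| ^ N ∂γ := by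
          refine setIntegral_mono_on (hf.sub hPi.integrableOn).abs hi.integrableOn hSm fun y hy => ?_
          have hx : 1 ≤ y + m := by linarith [hy.1]
          have hy1 : |y / m| ≤ 1 := by
            rw [abs_div, abs_of_pos hm0, div_le_one hm0, abs_le]
            constructor <;> linarith [hy.1, hy.2]
          rw [hP, tayP_rem N m y hm0.ne' (by linarith)]
          have h1 : |(N : ℝ) + 1 + N * (y / m)| ≤ 2 * N + 1 := by
            have h2 := abs_le.1 hy1
            have hN0 : (0 : ℝ) ≤ N := by positivity
            rw [abs_le]; constructor <;> nlinarith
          rw [abs_div, abs_mul, abs_mul, abs_pow, abs_neg, abs_one, one_pow, one_mul, abs_pow]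
          calc |y / m| ^ N * |(N : ℝ) + 1 + N * (y / m)| / |(y + m) ^ 2|
              ≤ |y / m| ^ N * |(N : ℝ) + 1 + N * (y / m)| := by
                refine div_le_self (by positivity) ?_
                rw [abs_of_nonneg (by positivity)]
                exact one_le_pow₀ hx
            _ ≤ |y / m| ^ N * (2 * N + 1) := by gcongr
            _ = _ := by rw [abs_div, abs_of_pos hm0, div_pow]; ring
      _ ≤ ∫ y, ((2 * (N : ℝ) + 1) / m ^ N) * |y| ^ N ∂γ :=
          setIntegral_le_integral hi (Filter.Eventually.of_forall fun y => by
            simp only [Pi.zero_apply]; positivity)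
      _ = _ := by rw [integral_const_mul]; ring
  have hsplit : (∫ y in S, 1 / (y + m) ^ 2 ∂γ) - p * e =
      (∫ y in S, (1 / (y + m) ^ 2 - P y) ∂γ) + ∫ y in S, (P y - e) ∂γ := by
    rw [integral_sub hf hPi.integrableOn,
      integral_sub hPi.integrableOn (integrable_const e).integrableOn, setIntegral_const, hpr,
      smul_eq_mul]
    ring
  have hfin : |(∫ y in S, 1 / (y + m) ^ 2 ∂γ) - p * e| ≤ D / m ^ N := by
    rw [hsplit]
    refine (abs_add_le _ _).trans ((add_le_add hrem htail).trans (le_of_eq ?_))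
    rw [hD]; ring
  have e1 : (∫ y in S, 1 / (y + m) ^ 2 ∂γ) / p - e =
      ((∫ y in S, 1 / (y + m) ^ 2 ∂γ) - p * e) / p := by
    field_simp
  rw [e1, abs_div, abs_of_pos hp0, div_le_iff₀ hp0, div_mul_cancel₀ _ (by positivity)]
  refine hfin.trans ?_
  rw [show 2 * k + 2 = N by rw [hN]; ring, div_mul_eq_mul_div]
  gcongr
  nlinarith


/-- Taylor expansion of the conditional second moment of the reciprocal of a Gaussian `N(m, σ²)`
given `S_m = [1, 2m−1]`:
`E[1/X² | S_m] = (1/m²) ∑_{j=0}^k (2j+1)!! σ^{2j}/m^{2j} + O(σ^{2k+2}/m^{2k+2})`. -/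
theorem conditional_second_moment_reciprocal_gaussian_taylor (σ : ℝ) (hσ : 0 < σ)
    (k : ℕ) (hk : 1 ≤ k) :
    ∃ C : ℝ, 0 < C ∧ ∃ M : ℝ, 1 < M ∧ ∀ m : ℝ, M ≤ m →
      |(∫ x in Icc 1 (2 * m - 1), (1 / x ^ 2) ∂(gaussianReal m ⟨σ ^ 2, sq_nonneg σ⟩)) /
            ((gaussianReal m ⟨σ ^ 2, sq_nonneg σ⟩) (Icc 1 (2 * m - 1))).toReal -
          (1 / m ^ 2) * ∑ j ∈ Finset.range (k + 1),
            (∏ i ∈ Finset.range (j + 1), (2 * (i : ℝ) + 1)) * σ ^ (2 * j) / m ^ (2 * j)| ≤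
        C * σ ^ (2 * k + 2) / m ^ (2 * k + 2) := by
  exact main_aux σ hσ ⟨σ ^ 2, sq_nonneg σ⟩ rfl k
end
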